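/- arXiv:2101.00525 — 3 statements merged into one kernel-verified Lean document; each statement's English description precedes it below -/
import Mathlib

section
/- Let γ_d = ∑_{n=0}^∞ ∑_{n₁+⋯+n_d=n, n_j ≥ 0} (n!/(n₁!⋯n_d!))² d^{−2n}. Then γ_d = ∞ for d ∈ {1, 2, 3}, and γ_d < ∞ for every integer d ≥ 4. -/
/-- `γ_d = ∑_{n≥0} ∑_{n₁+⋯+n_d=n} (n!/(n₁!⋯n_d!))² d^{−2n} ∈ (0,∞]`. -/
noncomputable def gammaD (d : ℕ) : ENNReal :=
  ∑' n : ℕ, ∑ f ∈ Finset.Nat.antidiagonalTuple d n,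
    ((Nat.multinomial Finset.univ f : ENNReal)) ^ 2 * (((d : ENNReal)) ^ (2 * n))⁻¹

/-- The sum of the squares of the multinomial coefficients of `n` into `d` parts. -/
noncomputable def multinomialSqSum (d n : ℕ) : ℝ :=
  ∑ f ∈ Finset.Nat.antidiagonalTuple d n, (Nat.multinomial Finset.univ f : ℝ) ^ 2

lemma gammaD_eq_tsum_ofReal (d : ℕ) :
    gammaD d = ∑' n, ENNReal.ofReal (multinomialSqSum d n * ((d : ℝ) ^ (2 * n))⁻¹) := by
  refine tsum_congr fun n => ?_
  rcases Nat.eq_zero_or_pos d with rfl | hd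
  · cases n <;> simp [multinomialSqSum]
  · have hd' : (0 : ℝ) < (d : ℝ) ^ (2 * n) := by positivity
    rw [← Finset.sum_mul, multinomialSqSum,
      ENNReal.ofReal_mul (Finset.sum_nonneg fun _ _ => sq_nonneg _),
      ENNReal.ofReal_sum_of_nonneg (fun _ _ => sq_nonneg _), ENNReal.ofReal_inv_of_pos hd',
      ENNReal.ofReal_pow (by positivity)]
    simp [ENNReal.ofReal_pow]

open PowerSeries in
lemma multinomialSqSum_eq_coeff (d n : ℕ) :
    multinomialSqSum d n =
      (n.factorial : ℝ) ^ 2 *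
        coeff n ((mk fun k => ((k.factorial : ℝ) ^ 2)⁻¹ : PowerSeries ℝ) ^ d) := by
  have h := coeff_prod (fun _ : Fin d => (mk fun k => ((k.factorial : ℝ) ^ 2)⁻¹ : PowerSeries ℝ))
    n Finset.univ
  rw [Finset.prod_const, Finset.card_univ, Fintype.card_fin] at h
  rw [h, Finset.mul_sum, multinomialSqSum]
  symm
  refine Finset.sum_equiv Finsupp.equivFunOnFinite ?_ ?_
  · intro f
    simp [Finset.mem_finsuppAntidiag, Finset.Nat.mem_antidiagonalTuple]
  · intro f hf
    have hs : ∑ i, f i = n := by simpa [Finset.mem_finsuppAntidiag] using hf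
    have hm := Nat.multinomial_spec Finset.univ (fun i => f i)
    rw [hs] at hm
    have hm' : (∏ i, ((f i).factorial : ℝ)) * (Nat.multinomial Finset.univ fun i => f i : ℕ) =
        n.factorial := by exact_mod_cast hm
    have hp : (∏ i, ((f i).factorial : ℝ)) ≠ 0 :=
      Finset.prod_ne_zero_iff.2 fun i _ => by positivity
    simp only [coeff_mk, Finset.prod_inv_distrib, Finset.prod_pow, ← hm']
    change _ = ((Nat.multinomial Finset.univ fun i => f i : ℕ) : ℝ) ^ 2
    field_simp

lemma multinomialSqSum_add (a b n : ℕ) :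
    multinomialSqSum (a + b) n = ∑ p ∈ Finset.HasAntidiagonal.antidiagonal n,
      (n.choose p.1 : ℝ) ^ 2 * (multinomialSqSum a p.1 * multinomialSqSum b p.2) := by
  simp only [multinomialSqSum_eq_coeff]
  rw [pow_add, PowerSeries.coeff_mul, Finset.mul_sum]
  refine Finset.sum_congr rfl fun p hp => ?_
  obtain rfl := Finset.HasAntidiagonal.mem_antidiagonal.1 hp
  have h : (((p.1 + p.2).choose p.1 : ℕ) : ℝ) * p.1.factorial * p.2.factorial =
      (p.1 + p.2).factorial := by
    rw [Nat.choose_symm_add]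
    exact_mod_cast Nat.add_choose_mul_factorial_mul_factorial p.1 p.2
  rw [← h]
  ring

lemma multinomialSqSum_nonneg (d n : ℕ) : 0 ≤ multinomialSqSum d n :=
  Finset.sum_nonneg fun _ _ => sq_nonneg _

lemma multinomialSqSum_one (n : ℕ) : multinomialSqSum 1 n = 1 := by
  have : (n.factorial : ℝ) ≠ 0 := by positivity
  rw [multinomialSqSum_eq_coeff]
  simp [this]

lemma multinomialSqSum_two (n : ℕ) : multinomialSqSum 2 n = n.centralBinom := by
  rw [multinomialSqSum_add 1 1, Nat.centralBinom, ← Nat.sum_range_choose_sq,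
    Finset.Nat.sum_antidiagonal_eq_sum_range_succ_mk]
  simp [multinomialSqSum_one]

lemma centralBinom_sq_mul_le (n : ℕ) : (n.centralBinom : ℝ) ^ 2 * (2 * n + 1) ≤ 16 ^ n := by
  induction n with
  | zero => simp
  | succ n ih =>
    have h : ((n : ℝ) + 1) * (n + 1).centralBinom = 2 * (2 * n + 1) * n.centralBinom := by
      exact_mod_cast Nat.succ_mul_centralBinom_succ n
    have h1 : ((n + 1).centralBinom : ℝ) = 2 * (2 * n + 1) * n.centralBinom / (n + 1) := by
      field_simp; linarith
    rw [h1, div_pow, div_mul_eq_mul_div, div_le_iff₀ (by positivity), pow_succ _ n]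
    push_cast
    have h2 : ((2 * (2 * n + 1) * n.centralBinom) ^ 2 * (2 * (n + 1) + 1) : ℝ) =
      ((n.centralBinom : ℝ) ^ 2 * (2 * n + 1)) * (4 * (2 * n + 1) * (2 * n + 3)) := by ring
    rw [h2]
    calc _ ≤ (16 : ℝ) ^ n * (4 * (2 * n + 1) * (2 * n + 3)) := by gcongr
      _ ≤ (16 : ℝ) ^ n * (16 * (n + 1) ^ 2) :=
        mul_le_mul_of_nonneg_left (by nlinarith) (by positivity)
      _ = _ := by ring

lemma le_centralBinom_sq_mul (n : ℕ) : 16 ^ n ≤ (n.centralBinom : ℝ) ^ 2 * (4 * n + 1) := by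
  induction n with
  | zero => simp
  | succ n ih =>
    have h : ((n : ℝ) + 1) * (n + 1).centralBinom = 2 * (2 * n + 1) * n.centralBinom := by
      exact_mod_cast Nat.succ_mul_centralBinom_succ n
    have h1 : ((n + 1).centralBinom : ℝ) = 2 * (2 * n + 1) * n.centralBinom / (n + 1) := by
      field_simp; linarith
    rw [h1, div_pow, div_mul_eq_mul_div, le_div_iff₀ (by positivity), pow_succ _ n]
    push_cast
    calc (16 : ℝ) ^ n * 16 * (n + 1) ^ 2
        ≤ ((n.centralBinom : ℝ) ^ 2 * (4 * n + 1)) * 16 * (n + 1) ^ 2 := by gcongr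
      _ = (n.centralBinom : ℝ) ^ 2 * (16 * (4 * n + 1) * (n + 1) ^ 2) := by ring
      _ ≤ (n.centralBinom : ℝ) ^ 2 * (4 * (2 * n + 1) ^ 2 * (4 * n + 5)) :=
        mul_le_mul_of_nonneg_left (by nlinarith) (by positivity)
      _ = _ := by ring

lemma choose_sq_mul_le (n k : ℕ) : (n.choose k : ℝ) ^ 2 * (n + 1) ≤ 4 ^ n := by
  have hk : (n.choose k : ℝ) ≤ n.choose (n / 2) := by exact_mod_cast Nat.choose_le_middle k n
  refine le_trans (by gcongr) (?_ : (n.choose (n / 2) : ℝ) ^ 2 * (n + 1) ≤ 4 ^ n)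
  obtain ⟨m, rfl | rfl⟩ := Nat.even_or_odd' n
  · have := centralBinom_sq_mul_le m
    rw [Nat.centralBinom] at this
    rw [Nat.mul_div_cancel_left _ two_pos, pow_mul]
    push_cast
    norm_num
    exact this
  · have h1 := centralBinom_sq_mul_le (m + 1)
    have h2 : ((m + 1).centralBinom : ℝ) = 2 * ((2 * m + 1).choose m : ℕ) := by
      rw [Nat.centralBinom_eq_two_mul_choose, mul_add, mul_one,
        show 2 * m + 2 = 2 * m + 1 + 1 from rfl, Nat.choose_succ_succ,
        Nat.choose_symm_half]
      push_cast; ring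
    have h3 : (2 * m + 1) / 2 = m := by omega
    rw [h2] at h1
    rw [h3, pow_succ _ (2 * m), pow_mul]
    rw [pow_succ _ m] at h1
    push_cast at h1 ⊢
    norm_num
    nlinarith [sq_nonneg (((2 * m + 1).choose m : ℕ) : ℝ)]

lemma centralBinom_div_four_pow_sq_le (n : ℕ) :
    ((n.centralBinom : ℝ) / 4 ^ n) ^ 2 ≤ 1 / (n + 1) := by
  have h := centralBinom_sq_mul_le n
  have h4 : ((4 : ℝ) ^ n) ^ 2 = 16 ^ n := by rw [← pow_mul, mul_comm, pow_mul]; norm_num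
  rw [div_pow, h4, div_le_div_iff₀ (by positivity) (by positivity)]
  nlinarith [sq_nonneg (n.centralBinom : ℝ), Nat.cast_nonneg (α := ℝ) n]

lemma sum_choose_div_succ_le (n : ℕ) :
    ∑ p ∈ Finset.HasAntidiagonal.antidiagonal n, (n.choose p.1 : ℝ) * (1 / (p.1 + 1)) ≤
      2 ^ (n + 1) / (n + 1) := by
  rw [Finset.Nat.sum_antidiagonal_eq_sum_range_succ_mk]
  have h : ∀ k ∈ Finset.range (n + 1), (n.choose k : ℝ) * (1 / (k + 1)) =
      ((n + 1).choose (k + 1) : ℕ) / (n + 1) := fun k _ => by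
    have h := Nat.add_one_mul_choose_eq n k
    have h' : ((n : ℝ) + 1) * n.choose k = (n + 1).choose (k + 1) * (k + 1) := by exact_mod_cast h
    field_simp
    linarith
  rw [Finset.sum_congr rfl h, ← Finset.sum_div]
  gcongr
  have h2 := Nat.sum_range_choose (n + 1)
  rw [Finset.sum_range_succ'] at h2
  have h3 : ∑ k ∈ Finset.range (n + 1), (n + 1).choose (k + 1) ≤ 2 ^ (n + 1) := by omega
  exact_mod_cast h3

lemma multinomialSqSum_four_le (n : ℕ) :
    multinomialSqSum 4 n * (((4 : ℕ) : ℝ) ^ (2 * n))⁻¹ ≤ 2 * (1 / ((n : ℝ) + 1) ^ (3 / 2 : ℝ)) := by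
  have hs : 0 < √((n : ℝ) + 1) := by positivity
  have hs2 : √((n : ℝ) + 1) ^ 2 = n + 1 := Real.sq_sqrt (by positivity)
  have hpow : ((n : ℝ) + 1) ^ (3 / 2 : ℝ) = (n + 1) * √((n : ℝ) + 1) := by
    rw [Real.sqrt_eq_rpow, show (3 / 2 : ℝ) = 1 + 1 / 2 by norm_num,
      Real.rpow_add (by positivity), Real.rpow_one]
  have hc : ∀ k, (n.choose k : ℝ) ≤ 2 ^ n / √((n : ℝ) + 1) := fun k => by
    rw [le_div_iff₀ hs, ← pow_le_pow_iff_left₀ (by positivity) (by positivity) two_ne_zero,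
      mul_pow, hs2, ← pow_mul, mul_comm n 2, pow_mul]
    norm_num
    exact choose_sq_mul_le n k
  have hterm : ∀ p ∈ Finset.HasAntidiagonal.antidiagonal n,
      (n.choose p.1 : ℝ) ^ 2 * (multinomialSqSum 2 p.1 * multinomialSqSum 2 p.2) ≤
      2 ^ n / √((n : ℝ) + 1) * 4 ^ n / 2 * ((n.choose p.1 : ℝ) * (1 / (p.1 + 1)) +
        (n.choose p.2 : ℝ) * (1 / (p.2 + 1))) := fun p hp => by
    obtain hp' := Finset.HasAntidiagonal.mem_antidiagonal.1 hp
    have h1 := centralBinom_div_four_pow_sq_le p.1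
    have h2 := centralBinom_div_four_pow_sq_le p.2
    have h3 : (p.1.centralBinom : ℝ) * p.2.centralBinom =
        4 ^ n * ((p.1.centralBinom / 4 ^ p.1) * (p.2.centralBinom / 4 ^ p.2)) := by
      rw [← hp', pow_add]; field_simp
    have h4 : (p.1.centralBinom : ℝ) * p.2.centralBinom ≤
        4 ^ n * ((1 / (p.1 + 1) + 1 / (p.2 + 1)) / 2) := by
      rw [h3]
      gcongr
      nlinarith [sq_nonneg ((p.1.centralBinom : ℝ) / 4 ^ p.1 - p.2.centralBinom / 4 ^ p.2)]
    have h5 : n.choose p.2 = n.choose p.1 := Nat.choose_symm_of_eq_add (by omega)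
    rw [multinomialSqSum_two, multinomialSqSum_two, h5, sq]
    calc (n.choose p.1 : ℝ) * n.choose p.1 * (p.1.centralBinom * p.2.centralBinom)
        ≤ 2 ^ n / √((n : ℝ) + 1) * n.choose p.1 *
          (4 ^ n * ((1 / (p.1 + 1) + 1 / (p.2 + 1)) / 2)) := by
          gcongr; exact hc _
      _ = _ := by ring
  have hsum := Finset.sum_le_sum hterm
  rw [← multinomialSqSum_add 2 2, ← Finset.mul_sum, Finset.sum_add_distrib] at hsum
  have hswap : ∑ p ∈ Finset.HasAntidiagonal.antidiagonal n, (n.choose p.2 : ℝ) * (1 / (p.2 + 1)) =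
      ∑ p ∈ Finset.HasAntidiagonal.antidiagonal n, (n.choose p.1 : ℝ) * (1 / (p.1 + 1)) :=
    Finset.Nat.sum_antidiagonal_swap
      (f := fun p : ℕ × ℕ => (n.choose p.1 : ℝ) * (1 / (p.1 + 1)))
  rw [hswap] at hsum
  have hle := sum_choose_div_succ_le n
  rw [hpow, mul_inv_le_iff₀ (by positivity)]
  refine hsum.trans ?_
  calc _ ≤ 2 ^ n / √((n : ℝ) + 1) * 4 ^ n / 2 *
        (2 ^ (n + 1) / (n + 1) + 2 ^ (n + 1) / (n + 1)) := by gcongr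
    _ = 2 * (1 / (((n : ℝ) + 1) * √((n : ℝ) + 1))) * ((2 ^ n * 2 ^ n) * 4 ^ n) := by
        rw [pow_succ]; field_simp; norm_num
    _ = _ := by
        rw [← mul_pow, ← mul_pow, pow_mul]; norm_num

lemma gammaD_four_lt_top : gammaD 4 < ⊤ := by
  rw [gammaD_eq_tsum_ofReal]
  refine Summable.tsum_ofReal_lt_top (Summable.of_nonneg_of_le (fun n => ?_)
    multinomialSqSum_four_le (Summable.mul_left _ ?_))
  · exact mul_nonneg (multinomialSqSum_nonneg _ _) (by positivity)
  · have h := (summable_nat_add_iff 1).2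
      (Real.summable_one_div_nat_rpow.2 (by norm_num : (1 : ℝ) < 3 / 2))
    simpa using h

lemma gammaD_succ_le (d : ℕ) (hd : 1 ≤ d) :
    gammaD (d + 1) ≤ ENNReal.ofReal ((d + 1) / d) * gammaD d := by
  have hd0 : (0 : ℝ) < d := by exact_mod_cast hd
  set r : ℝ := 1 / (d + 1) with hr
  have hr0 : 0 < r := by positivity
  have hr1 : ‖r‖ < 1 := by
    rw [Real.norm_of_nonneg hr0.le, hr, div_lt_one (by positivity)]; linarith
  have hgeom : ∀ j : ℕ, HasSum (fun i : ℕ => ((i + j).choose j : ℝ) * r ^ i * (d * r) ^ j)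
      ((d + 1) / d) := fun j => by
    have h := (hasSum_choose_mul_geometric_of_norm_lt_one j hr1).mul_right ((d * r) ^ j)
    have h1 : 1 - r = d * r := by rw [hr]; field_simp; ring
    have h2 : 1 / (1 - r) ^ (j + 1) * (d * r) ^ j = (d + 1) / d := by
      rw [h1, pow_succ, hr]
      field_simp
    rwa [h2] at h
  have hbound : ∀ i j : ℕ, ((i + j).choose j : ℝ) * r ^ i * (d * r) ^ j ≤ 1 := fun i j => by
    have h := add_pow (d * r) r (i + j)
    rw [show (d * r + r : ℝ) = 1 by rw [hr]; field_simp, one_pow] at h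
    rw [h]
    refine le_trans (le_of_eq ?_) (Finset.single_le_sum (f := fun m : ℕ =>
      (d * r) ^ m * r ^ (i + j - m) * ((i + j).choose m : ℝ)) (fun m _ => by positivity)
      (Finset.mem_range.2 (by omega : j < i + j + 1)))
    simp only [Nat.add_sub_cancel]
    ring
  set u : ℕ → ℝ := fun j => multinomialSqSum d j * ((d : ℝ) ^ (2 * j))⁻¹ with hu
  have hu0 : ∀ j, 0 ≤ u j := fun j =>
    mul_nonneg (multinomialSqSum_nonneg _ _) (by positivity)
  have hterm : ∀ n, ENNReal.ofReal (multinomialSqSum (d + 1) n * (((d + 1 : ℕ) : ℝ) ^ (2 * n))⁻¹) ≤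
      ∑ p : Finset.HasAntidiagonal.antidiagonal n, ENNReal.ofReal
        (((p.1.1 + p.1.2).choose p.1.2 : ℝ) * r ^ p.1.1 * (d * r) ^ p.1.2) *
        ENNReal.ofReal (u p.1.2) := fun n => by
    rw [Finset.sum_coe_sort (Finset.HasAntidiagonal.antidiagonal n) (fun p : ℕ × ℕ =>
      ENNReal.ofReal (((p.1 + p.2).choose p.2 : ℝ) * r ^ p.1 * (d * r) ^ p.2) *
        ENNReal.ofReal (u p.2))]
    simp_rw [← ENNReal.ofReal_mul' (hu0 _)]
    rw [← ENNReal.ofReal_sum_of_nonneg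
      (fun p _ => mul_nonneg (by positivity) (hu0 _))]
    refine ENNReal.ofReal_le_ofReal ?_
    rw [add_comm d 1, multinomialSqSum_add, Finset.sum_mul]
    refine Finset.sum_le_sum fun p hp => ?_
    obtain rfl := Finset.HasAntidiagonal.mem_antidiagonal.1 hp
    set b : ℝ := ((p.1 + p.2).choose p.2 : ℝ) * r ^ p.1 * (d * r) ^ p.2 with hb
    have hb0 : 0 ≤ b := by positivity
    calc _ = b ^ 2 * u p.2 := by
          rw [multinomialSqSum_one, hb, hu, hr, Nat.choose_symm_add]
          push_cast
          simp only [pow_mul', pow_add, mul_pow, one_div, inv_pow]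
          field_simp
          ring
      _ ≤ b * u p.2 := by
          refine mul_le_mul_of_nonneg_right ?_ (hu0 _)
          nlinarith [hbound p.1 p.2]
  rw [gammaD_eq_tsum_ofReal, gammaD_eq_tsum_ofReal d]
  calc _ ≤ ∑' n, ∑ p : Finset.HasAntidiagonal.antidiagonal n, ENNReal.ofReal
        (((p.1.1 + p.1.2).choose p.1.2 : ℝ) * r ^ p.1.1 * (d * r) ^ p.1.2) *
        ENNReal.ofReal (u p.1.2) := ENNReal.tsum_le_tsum hterm
    _ = ∑' q : ℕ × ℕ, ENNReal.ofReal
        (((q.1 + q.2).choose q.2 : ℝ) * r ^ q.1 * (d * r) ^ q.2) * ENNReal.ofReal (u q.2) := by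
        rw [← Finset.HasAntidiagonal.sigmaAntidiagonalEquivProd.tsum_eq, ENNReal.tsum_sigma']
        refine tsum_congr fun n => ?_
        rw [tsum_fintype]
        rfl
    _ = ∑' j, ∑' i, ENNReal.ofReal
        (((i + j).choose j : ℝ) * r ^ i * (d * r) ^ j) * ENNReal.ofReal (u j) := by
        rw [ENNReal.tsum_prod', ENNReal.tsum_comm]
    _ = _ := by
        rw [← ENNReal.tsum_mul_left]
        refine tsum_congr fun j => ?_
        rw [ENNReal.tsum_mul_right, ← ENNReal.ofReal_tsum_of_nonneg (fun i => by positivity)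
          (hgeom j).summable, (hgeom j).tsum_eq]

lemma tsum_ofReal_eq_top_of_le {c : ℝ} (hc : 0 < c) {a : ℕ → ℝ}
    (h : ∀ n : ℕ, c * (1 / ((n : ℝ) + 1)) ≤ a n) : ∑' n, ENNReal.ofReal (a n) = ⊤ := by
  by_contra hne
  have ha : ∀ n, 0 ≤ a n := fun n => le_trans (by positivity) (h n)
  have hs : Summable a := by
    convert ENNReal.summable_toReal hne using 2 with n
    rw [ENNReal.toReal_ofReal (ha n)]
  have h1 := (summable_mul_left_iff hc.ne').1 (Summable.of_nonneg_of_le (fun n => by positivity) h hs)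
  refine Real.not_summable_one_div_natCast ((summable_nat_add_iff 1).1 ?_)
  simpa using h1

/-- The binomial distribution with parameter `2 / 3` is not too spread out. -/
lemma nine_pow_le_mul_sum_choose_mul_two_pow_sq (n : ℕ) :
    (9 : ℝ) ^ n ≤ 4 * (2 * (n.sqrt + 1) + 1) *
      ∑ k ∈ Finset.range (n + 1), ((n.choose k : ℝ) * 2 ^ k) ^ 2 := by
  set s := n.sqrt + 1 with hs
  set b : ℕ → ℝ := fun k => (n.choose k : ℝ) * 2 ^ k with hb
  have hb0 : ∀ k, 0 ≤ b k := fun k => by positivity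
  have hsum : ∑ k ∈ Finset.range (n + 1), b k = 3 ^ n := by
    have h := add_pow (2 : ℝ) 1 n
    norm_num at h
    rw [h]
    exact Finset.sum_congr rfl fun k _ => mul_comm _ _
  have hvar : ∑ k ∈ Finset.range (n + 1), (2 * (n : ℝ) - 3 * k) ^ 2 * b k = 2 * (n : ℝ) * 3 ^ n := by
    have h := congrArg (Polynomial.eval (2 / 3 : ℝ)) (bernsteinPolynomial.variance ℝ n)
    simp only [Polynomial.eval_finsetSum, bernsteinPolynomial, Polynomial.eval_mul,
      Polynomial.eval_pow, Polynomial.eval_sub, Polynomial.eval_X,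
      Polynomial.eval_natCast, Polynomial.eval_one, nsmul_eq_mul] at h
    have h9 : ∑ k ∈ Finset.range (n + 1), (2 * (n : ℝ) - 3 * k) ^ 2 * b k =
        9 * 3 ^ n * ∑ k ∈ Finset.range (n + 1), ((n : ℝ) * (2 / 3) - k) ^ 2 *
          (n.choose k * (2 / 3) ^ k * (1 - 2 / 3) ^ (n - k)) := by
      rw [Finset.mul_sum]
      refine Finset.sum_congr rfl fun k hk => ?_
      have hk' : k ≤ n := by simpa [Nat.lt_succ_iff] using hk
      have h3 : (3 : ℝ) ^ n = 3 ^ k * 3 ^ (n - k) := by rw [← pow_add, Nat.add_sub_cancel' hk']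
      rw [h3, hb, show (1 - 2 / 3 : ℝ) = 1 / 3 by norm_num, div_pow, div_pow, one_pow]
      field_simp
      ring
    rw [h9, h]
    ring
  set A := (Finset.range (n + 1)).filter fun k => k ∈ Finset.Icc (2 * n / 3 - s) (2 * n / 3 + s)
    with hA
  have hcard : (A.card : ℝ) ≤ 2 * s + 1 := by
    have h : A.card ≤ (Finset.Icc (2 * n / 3 - s) (2 * n / 3 + s)).card :=
      Finset.card_le_card fun k hk => (Finset.mem_filter.1 hk).2
    rw [Nat.card_Icc] at h
    have h' : A.card ≤ 2 * s + 1 := by omega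
    exact_mod_cast h'
  have hout : ∑ k ∈ (Finset.range (n + 1)).filter
      (fun k => k ∉ Finset.Icc (2 * n / 3 - s) (2 * n / 3 + s)), (9 * ((n : ℝ) + 1)) * b k ≤
      2 * (n : ℝ) * 3 ^ n := by
    rw [← hvar]
    refine (Finset.sum_le_sum fun k hk => ?_).trans (Finset.sum_le_sum_of_subset_of_nonneg
      (Finset.filter_subset _ _) fun k _ _ => mul_nonneg (sq_nonneg _) (hb0 k))
    refine mul_le_mul_of_nonneg_right ?_ (hb0 k)
    have hk' := (Finset.mem_filter.1 hk).2
    rw [Finset.mem_Icc, not_and_or, not_le, not_le] at hk'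
    have hsn : (n : ℝ) + 1 ≤ (s : ℝ) ^ 2 := by
      have := Nat.lt_succ_sqrt n
      rw [sq]
      exact_mod_cast this
    have hs0 : (0 : ℝ) ≤ s := by positivity
    rcases hk' with hk' | hk'
    · have h : 3 * k + 3 * s ≤ 2 * n := by omega
      have h' : 3 * (k : ℝ) + 3 * s ≤ 2 * n := by exact_mod_cast h
      nlinarith
    · have h : 2 * n + 3 * s ≤ 3 * k := by omega
      have h' : 2 * (n : ℝ) + 3 * s ≤ 3 * k := by exact_mod_cast h
      nlinarith
  rw [← Finset.mul_sum] at hout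
  have hsplit := Finset.sum_filter_add_sum_filter_not (Finset.range (n + 1))
    (fun k => k ∈ Finset.Icc (2 * n / 3 - s) (2 * n / 3 + s)) b
  rw [← hA, hsum] at hsplit
  have hin : (3 : ℝ) ^ n / 2 ≤ ∑ k ∈ A, b k := by
    have h3 : (0 : ℝ) < 3 ^ n := by positivity
    have hn : (0 : ℝ) ≤ n := by positivity
    by_contra! hlt
    nlinarith
  calc (9 : ℝ) ^ n
      = 4 * (3 ^ n / 2) ^ 2 := by
        rw [div_pow, ← pow_mul, mul_comm n 2, pow_mul]; norm_num; ring
    _ ≤ 4 * (∑ k ∈ A, b k) ^ 2 := by gcongr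
    _ ≤ 4 * (A.card * ∑ k ∈ A, b k ^ 2) := by gcongr; exact sq_sum_le_card_mul_sum_sq
    _ ≤ 4 * ((2 * s + 1) * ∑ k ∈ Finset.range (n + 1), b k ^ 2) := by
        gcongr
        exact Finset.filter_subset _ _
    _ = _ := by rw [hs]; push_cast; ring

lemma gammaD_one : gammaD 1 = ⊤ := by
  rw [gammaD_eq_tsum_ofReal]
  refine tsum_ofReal_eq_top_of_le one_pos fun n => ?_
  simp only [multinomialSqSum_one, Nat.cast_one, one_pow, inv_one, one_mul]
  rw [div_le_one (by positivity)]
  linarith [Nat.cast_nonneg (α := ℝ) n]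

lemma gammaD_two : gammaD 2 = ⊤ := by
  rw [gammaD_eq_tsum_ofReal]
  refine tsum_ofReal_eq_top_of_le (c := 1 / 4) (by norm_num) fun n => ?_
  have hn : (0 : ℝ) ≤ n := by positivity
  have h := le_centralBinom_sq_mul n
  rw [multinomialSqSum_two, pow_mul, ← div_eq_mul_inv, le_div_iff₀ (by positivity)]
  push_cast
  norm_num
  have h4 : ((4 : ℝ) ^ n) ^ 2 = 16 ^ n := by rw [← pow_mul, mul_comm, pow_mul]; norm_num
  have h5 : (4 : ℝ) ^ n ≤ n.centralBinom * (4 * (n + 1)) := by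
    rw [← pow_le_pow_iff_left₀ (by positivity) (by positivity) two_ne_zero, h4, mul_pow]
    refine h.trans ?_
    gcongr
    nlinarith
  have h6 : (0 : ℝ) < n + 1 := by positivity
  field_simp
  linarith

lemma gammaD_three : gammaD 3 = ⊤ := by
  rw [gammaD_eq_tsum_ofReal]
  refine tsum_ofReal_eq_top_of_le (c := 1 / 100) (by norm_num) fun n => ?_
  have hn : (0 : ℝ) ≤ n := by positivity
  set t : ℝ := 2 * (n.sqrt + 1) + 1 with ht
  have ht0 : 0 < t := by positivity
  have ht1 : (4 * (n : ℝ) + 1) ≤ t ^ 2 := by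
    have h : (n : ℝ) + 1 ≤ (n.sqrt + 1) * (n.sqrt + 1) := by
      exact_mod_cast Nat.lt_succ_sqrt n
    have : (0 : ℝ) ≤ n.sqrt := by positivity
    rw [ht]
    nlinarith
  have ht2 : t ^ 2 ≤ 25 * (n + 1) := by
    have h : (n.sqrt : ℝ) * n.sqrt ≤ n := by exact_mod_cast Nat.sqrt_le n
    rw [ht]
    nlinarith [sq_nonneg ((n.sqrt : ℝ) - 1)]
  have hcb : ∀ k ∈ Finset.range (n + 1), ((n.choose k : ℝ) * 2 ^ k) ^ 2 / t ≤
      (n.choose k : ℝ) ^ 2 * (multinomialSqSum 2 k * multinomialSqSum 1 (n - k)) := fun k hk => by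
    have hk' : (k : ℝ) ≤ n := by
      exact_mod_cast Nat.lt_succ_iff.1 (Finset.mem_range.1 hk)
    have h4 : ((4 : ℝ) ^ k) ^ 2 = 16 ^ k := by rw [← pow_mul, mul_comm, pow_mul]; norm_num
    have h2 : ((2 : ℝ) ^ k) ^ 2 = 4 ^ k := by rw [← pow_mul, mul_comm, pow_mul]; norm_num
    have h : (4 : ℝ) ^ k ≤ k.centralBinom * t := by
      rw [← pow_le_pow_iff_left₀ (by positivity) (by positivity) two_ne_zero, h4, mul_pow]
      refine (le_centralBinom_sq_mul k).trans ?_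
      gcongr
      linarith
    rw [multinomialSqSum_one, multinomialSqSum_two, mul_one, div_le_iff₀ ht0, mul_pow, h2,
      mul_assoc]
    gcongr
  have h := Finset.sum_le_sum hcb
  have hadd := multinomialSqSum_add 2 1 n
  rw [Finset.Nat.sum_antidiagonal_eq_sum_range_succ_mk] at hadd
  rw [← Finset.sum_div] at h
  have h9 := nine_pow_le_mul_sum_choose_mul_two_pow_sq n
  rw [← ht] at h9
  have h3 : (9 : ℝ) ^ n ≤ 4 * t ^ 2 * multinomialSqSum 3 n := by
    refine h9.trans ?_
    rw [← hadd, div_le_iff₀ ht0] at h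
    calc _ ≤ 4 * t * (multinomialSqSum (2 + 1) n * t) := by gcongr
      _ = _ := by ring
  have h0 := multinomialSqSum_nonneg 3 n
  rw [pow_mul, ← div_eq_mul_inv, le_div_iff₀ (by positivity)]
  push_cast
  norm_num
  have h6 : (9 : ℝ) ^ n ≤ 4 * (25 * (n + 1)) * multinomialSqSum 3 n := h3.trans (by gcongr)
  field_simp
  linarith

/-- `γ_d = ∞` for `d ∈ {1,2,3}` and `γ_d < ∞` for `d ≥ 4`. -/
theorem stmt_6 :
    gammaD 1 = ⊤ ∧ gammaD 2 = ⊤ ∧ gammaD 3 = ⊤ ∧ ∀ d : ℕ, 4 ≤ d → gammaD d < ⊤ := by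
  refine ⟨gammaD_one, gammaD_two, gammaD_three, fun d hd => ?_⟩
  induction d, hd using Nat.le_induction with
  | base => exact gammaD_four_lt_top
  | succ d hd ih =>
    exact (gammaD_succ_le d (by omega)).trans_lt (ENNReal.mul_lt_top ENNReal.ofReal_lt_top ih)
end

section
/- For every real r > 3, (1/(r²−3)) · ₂F₁(1/3, 2/3; 1; 27(r²−1)/(r²−3)³) = (1/((r−1)^{3/2}(r+3)^{1/2})) · ₂F₁(1/2, 1/2; 1; 16r/((r−1)³(r+3))). -/
/-- The Gauss hypergeometric series `₂F₁(a,b;c;z) = ∑ (a)ₙ(b)ₙ/((c)ₙ n!) zⁿ`. -/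
noncomputable def hyp2F1 (a b c z : ℝ) : ℝ :=
  ∑' n : ℕ, ((ascPochhammer ℝ n).eval a * (ascPochhammer ℝ n).eval b) /
    ((ascPochhammer ℝ n).eval c * (n.factorial : ℝ)) * z ^ n

open Filter Topology Set

/-- The coefficient of `zⁿ` in `₂F₁(a,b;1;z)`. -/
noncomputable def hypCoeff (a b : ℝ) (n : ℕ) : ℝ :=
  ((ascPochhammer ℝ n).eval a * (ascPochhammer ℝ n).eval b) /
    ((ascPochhammer ℝ n).eval 1 * (n.factorial : ℝ))

/-- The power series of `z(1-z)F'(z)` where `F(z) = ₂F₁(a,b;1;z)` and `a + b = 1`. -/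
noncomputable def hypFluxCoeff (a b : ℝ) (n : ℕ) : ℝ :=
  a * b * hypCoeff a b (n - 1) / n

/-- The function `z(1-z)F'(z)` where `F(z) = ₂F₁(a,b;1;z)` and `a + b = 1`. -/
noncomputable def hypFlux (a b z : ℝ) : ℝ := ∑' n : ℕ, hypFluxCoeff a b n * z ^ n

lemma hyp2F1_eq_tsum_hypCoeff (a b z : ℝ) :
    hyp2F1 a b 1 z = ∑' n : ℕ, hypCoeff a b n * z ^ n := rfl

lemma hypCoeff_zero (a b : ℝ) : hypCoeff a b 0 = 1 := by simp [hypCoeff]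

lemma hypCoeff_pos {a b : ℝ} (ha : 0 < a) (hb : 0 < b) (n : ℕ) : 0 < hypCoeff a b n := by
  have h1 := ascPochhammer_pos n a ha
  have h2 := ascPochhammer_pos n b hb
  have h3 := ascPochhammer_pos n (1 : ℝ) one_pos
  unfold hypCoeff
  positivity

lemma hypCoeff_succ (a b : ℝ) (n : ℕ) :
    ((n : ℝ) + 1) ^ 2 * hypCoeff a b (n + 1) = (a + n) * (b + n) * hypCoeff a b n := by
  have h3 := ascPochhammer_pos n (1 : ℝ) one_pos
  have h4 : (0 : ℝ) < n.factorial := by positivity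
  unfold hypCoeff
  rw [ascPochhammer_succ_eval, ascPochhammer_succ_eval, ascPochhammer_succ_eval,
    Nat.factorial_succ]
  push_cast
  field_simp
  ring

lemma hypCoeff_le_one {a b : ℝ} (ha : 0 < a) (hb : 0 < b) (hab : a + b = 1) (n : ℕ) :
    hypCoeff a b n ≤ 1 := by
  induction n with
  | zero => simp [hypCoeff_zero]
  | succ n ih =>
    have h := hypCoeff_succ a b n
    have hp := hypCoeff_pos ha hb n
    have hn : (0 : ℝ) ≤ n := n.cast_nonneg
    have h1 : (a + n) * (b + n) ≤ ((n : ℝ) + 1) ^ 2 := by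
      obtain rfl : b = 1 - a := by linarith
      nlinarith [mul_pos ha hb]
    have h2 : ((n : ℝ) + 1) ^ 2 * hypCoeff a b (n + 1) ≤ ((n : ℝ) + 1) ^ 2 * 1 := by
      rw [h]
      exact mul_le_mul h1 ih hp.le (by positivity)
    exact le_of_mul_le_mul_left h2 (by positivity)

lemma abs_hypCoeff_le_one {a b : ℝ} (ha : 0 < a) (hb : 0 < b) (hab : a + b = 1) (n : ℕ) :
    |hypCoeff a b n| ≤ 1 := by
  rw [abs_of_pos (hypCoeff_pos ha hb n)]
  exact hypCoeff_le_one ha hb hab n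

lemma hypFluxCoeff_succ {a b : ℝ} (hab : a + b = 1) (n : ℕ) :
    hypFluxCoeff a b (n + 1) = (n + 1) * hypCoeff a b (n + 1) - n * hypCoeff a b n := by
  have h := hypCoeff_succ a b n
  obtain rfl : b = 1 - a := by linarith
  simp only [hypFluxCoeff, Nat.add_sub_cancel, Nat.cast_add, Nat.cast_one]
  rw [div_eq_iff (by positivity)]
  linear_combination -h

lemma abs_hypFluxCoeff_le_one {a b : ℝ} (ha : 0 < a) (hb : 0 < b) (hab : a + b = 1) (n : ℕ) :
    |hypFluxCoeff a b n| ≤ 1 := by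
  rcases n with _ | n
  · simp [hypFluxCoeff]
  · have hp := hypCoeff_pos ha hb n
    have h1 := hypCoeff_le_one ha hb hab n
    have h2 : a * b ≤ 1 := by nlinarith
    simp only [hypFluxCoeff, Nat.add_sub_cancel, Nat.cast_add, Nat.cast_one]
    rw [abs_of_pos (by positivity), div_le_one (by positivity)]
    have := mul_le_mul h2 h1 hp.le zero_le_one
    have hn : (0 : ℝ) ≤ n := n.cast_nonneg
    linarith

lemma summable_coeff_mul_pow {c : ℕ → ℝ} (hc : ∀ n, |c n| ≤ 1) {z : ℝ} (hz : |z| < 1) :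
    Summable fun n ↦ c n * z ^ n := by
  refine Summable.of_norm_bounded (summable_geometric_of_lt_one (abs_nonneg z) hz) fun n ↦ ?_
  rw [Real.norm_eq_abs, abs_mul, abs_pow]
  exact mul_le_of_le_one_left (by positivity) (hc n)

lemma summable_nat_mul_coeff_mul_pow {c : ℕ → ℝ} (hc : ∀ n, |c n| ≤ 1) {z : ℝ} (hz : |z| < 1) :
    Summable fun n : ℕ ↦ c n * (n * z ^ (n - 1)) := by
  have hs : Summable fun n : ℕ ↦ (n : ℝ) * |z| ^ (n - 1) := by
    rw [← summable_nat_add_iff 1]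
    have h1 := summable_pow_mul_geometric_of_norm_lt_one 1 (r := |z|) (by simpa using hz)
    have h2 := summable_geometric_of_lt_one (abs_nonneg z) hz
    refine (h1.add h2).congr fun n ↦ ?_
    simp only [Nat.add_sub_cancel, Nat.cast_add, Nat.cast_one]
    ring
  refine Summable.of_norm_bounded hs fun n ↦ ?_
  rw [Real.norm_eq_abs, abs_mul, abs_mul, abs_pow, Nat.abs_cast]
  exact mul_le_of_le_one_left (by positivity) (hc n)

lemma hasDerivAt_tsum_coeff_mul_pow {c : ℕ → ℝ} (hc : ∀ n, |c n| ≤ 1) {z : ℝ} (hz : |z| < 1) :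
    HasDerivAt (fun z ↦ ∑' n, c n * z ^ n) (∑' n : ℕ, (n + 1) * c (n + 1) * z ^ n) z := by
  obtain ⟨ρ, hρ, hρ1⟩ := exists_between hz
  have hρ0 : 0 < ρ := (abs_nonneg z).trans_lt hρ
  have hs := summable_nat_mul_coeff_mul_pow (c := fun _ ↦ 1) (by simp) (z := ρ)
    (by rwa [abs_of_pos hρ0])
  have key : HasDerivAt (fun z ↦ ∑' n, c n * z ^ n) (∑' n : ℕ, c n * (n * z ^ (n - 1))) z := by
    refine hasDerivAt_tsum_of_isPreconnected (t := Ioo (-ρ) ρ) (y₀ := 0) hs isOpen_Ioo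
      isPreconnected_Ioo (fun n y _ ↦ (hasDerivAt_pow n y).const_mul (c n)) ?_
      ⟨by linarith, hρ0⟩ (summable_coeff_mul_pow hc (by simp)) (abs_lt.mp hρ)
    intro n y hy
    rw [Real.norm_eq_abs, abs_mul, abs_mul, abs_pow, Nat.abs_cast]
    have : |y| ≤ ρ := (abs_lt.mpr hy).le
    exact mul_le_mul (hc n) (by gcongr) (by positivity) zero_le_one
  convert key using 1
  rw [(summable_nat_mul_coeff_mul_pow hc hz).tsum_eq_zero_add]
  simp only [Nat.cast_zero, zero_mul, mul_zero, zero_add, Nat.add_sub_cancel, Nat.cast_add,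
    Nat.cast_one]
  exact tsum_congr fun n ↦ by ring

lemma hasDerivAt_hypFlux {a b : ℝ} (ha : 0 < a) (hb : 0 < b) (hab : a + b = 1) {z : ℝ}
    (hz : |z| < 1) : HasDerivAt (hypFlux a b) (a * b * hyp2F1 a b 1 z) z := by
  refine (hasDerivAt_tsum_coeff_mul_pow (abs_hypFluxCoeff_le_one ha hb hab) hz).congr_deriv
    (Eq.symm ?_)
  rw [hyp2F1_eq_tsum_hypCoeff, ← tsum_mul_left]
  refine tsum_congr fun n ↦ ?_
  simp only [hypFluxCoeff, Nat.add_sub_cancel, Nat.cast_add, Nat.cast_one]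
  field_simp

lemma hasDerivAt_hyp2F1 {a b : ℝ} (ha : 0 < a) (hb : 0 < b) (hab : a + b = 1) {z : ℝ}
    (hz0 : z ≠ 0) (hz : |z| < 1) :
    HasDerivAt (hyp2F1 a b 1) (hypFlux a b z / (z * (1 - z))) z := by
  have hc := abs_hypCoeff_le_one ha hb hab
  refine (hasDerivAt_tsum_coeff_mul_pow hc hz).congr_deriv (Eq.symm ?_)
  have hz1 : 1 - z ≠ 0 := by linarith [(abs_lt.mp hz).2]
  rw [div_eq_iff (by positivity)]
  have hGs : Summable fun n : ℕ ↦ ((n : ℝ) + 1) * hypCoeff a b (n + 1) * z ^ n := by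
    refine ((summable_nat_add_iff 1).mpr (summable_nat_mul_coeff_mul_pow hc hz)).congr fun n ↦ ?_
    simp only [Nat.add_sub_cancel, Nat.cast_add, Nat.cast_one]
    ring
  have hG := hGs.hasSum
  set G := ∑' n : ℕ, ((n : ℝ) + 1) * hypCoeff a b (n + 1) * z ^ n
  have hsum : HasSum (fun n : ℕ ↦ (n : ℝ) * hypCoeff a b n * z ^ n) (z * G) := by
    rw [← hasSum_nat_add_iff' 1]
    simp only [Finset.sum_range_one, Nat.cast_zero, zero_mul, sub_zero]
    have h : (fun n : ℕ ↦ ((n + 1 : ℕ) : ℝ) * hypCoeff a b (n + 1) * z ^ (n + 1)) =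
        fun n : ℕ ↦ z * (((n : ℝ) + 1) * hypCoeff a b (n + 1) * z ^ n) := by
      ext n
      push_cast
      ring
    rw [h]
    exact hG.mul_left z
  have hV : HasSum (fun n : ℕ ↦ hypFluxCoeff a b n * z ^ n) (z * (G - z * G)) := by
    rw [← hasSum_nat_add_iff' 1]
    simp only [Finset.sum_range_one, hypFluxCoeff_succ hab]
    rw [show hypFluxCoeff a b 0 = 0 by simp [hypFluxCoeff], zero_mul, sub_zero]
    have h : (fun n : ℕ ↦ (((n : ℝ) + 1) * hypCoeff a b (n + 1) - n * hypCoeff a b n) *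
        z ^ (n + 1)) = fun n : ℕ ↦ z * (((n : ℝ) + 1) * hypCoeff a b (n + 1) * z ^ n -
          n * hypCoeff a b n * z ^ n) := by
      ext n
      ring
    rw [h]
    exact (hG.sub hsum).mul_left z
  rw [hypFlux, hV.tsum_eq]
  ring

lemma hypFlux_zero (a b : ℝ) : hypFlux a b 0 = 0 := by
  rw [hypFlux, tsum_eq_single 0]
  · simp [hypFluxCoeff]
  · intro n hn
    simp [hn]

lemma hyp2F1_zero (a b : ℝ) : hyp2F1 a b 1 0 = 1 := by
  rw [hyp2F1_eq_tsum_hypCoeff, tsum_eq_single 0]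
  · simp [hypCoeff_zero]
  · intro n hn
    simp [hn]

lemma continuousAt_hyp2F1_zero {a b : ℝ} (ha : 0 < a) (hb : 0 < b) (hab : a + b = 1) :
    ContinuousAt (hyp2F1 a b 1) 0 :=
  (hasDerivAt_tsum_coeff_mul_pow (abs_hypCoeff_le_one ha hb hab) (z := 0) (by simp)).continuousAt

lemma continuousAt_hypFlux_zero {a b : ℝ} (ha : 0 < a) (hb : 0 < b) (hab : a + b = 1) :
    ContinuousAt (hypFlux a b) 0 :=
  (hasDerivAt_hypFlux ha hb hab (by simp)).continuousAt

lemma hyp2F1_pos {a b : ℝ} (ha : 0 < a) (hb : 0 < b) (hab : a + b = 1) {z : ℝ} (hz0 : 0 ≤ z)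
    (hz1 : z < 1) : 0 < hyp2F1 a b 1 z := by
  have hs := summable_coeff_mul_pow (abs_hypCoeff_le_one ha hb hab) (z := z)
    (by rwa [abs_of_nonneg hz0])
  rw [hyp2F1_eq_tsum_hypCoeff]
  refine hs.tsum_pos (fun n ↦ ?_) 0 (by simp [hypCoeff_zero])
  have := hypCoeff_pos ha hb n
  positivity

/-- The argument of the cubic hypergeometric function. -/
noncomputable def cubicArg (r : ℝ) : ℝ := 27 * (r ^ 2 - 1) / (r ^ 2 - 3) ^ 3

/-- The argument of the quadratic hypergeometric function. -/
noncomputable def quadArg (r : ℝ) : ℝ := 16 * r / ((r - 1) ^ 3 * (r + 3))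

/-- The algebraic factor `(r-1)^(3/2) (r+3)^(1/2)`. -/
noncomputable def algFactor (r : ℝ) : ℝ := √((r - 1) ^ 3 * (r + 3))

lemma algFactor_pos {r : ℝ} (hr : 3 < r) : 0 < algFactor r := by
  have h1 : 0 < r - 1 := by linarith
  exact Real.sqrt_pos.mpr (by positivity)

lemma algFactor_sq {r : ℝ} (hr : 3 < r) : algFactor r ^ 2 = (r - 1) ^ 3 * (r + 3) := by
  have h1 : 0 < r - 1 := by linarith
  exact Real.sq_sqrt (by positivity)

lemma algFactor_eq_rpow {r : ℝ} (hr : 3 < r) :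
    algFactor r = (r - 1) ^ ((3 : ℝ) / 2) * (r + 3) ^ ((1 : ℝ) / 2) := by
  have h1 : 0 < r - 1 := by linarith
  rw [algFactor, Real.sqrt_mul (by positivity), Real.sqrt_eq_rpow, Real.sqrt_eq_rpow,
    ← Real.rpow_natCast, ← Real.rpow_mul h1.le]
  norm_num

lemma sq_sub_three_pos {r : ℝ} (hr : 3 < r) : 0 < r ^ 2 - 3 := by nlinarith

lemma one_sub_cubicArg {r : ℝ} (hr : 3 < r) :
    1 - cubicArg r = r ^ 4 * (r ^ 2 - 9) / (r ^ 2 - 3) ^ 3 := by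
  have h3 := sq_sub_three_pos hr
  unfold cubicArg
  field_simp
  ring

lemma one_sub_quadArg {r : ℝ} (hr : 3 < r) :
    1 - quadArg r = (r - 3) * (r + 1) ^ 3 / ((r - 1) ^ 3 * (r + 3)) := by
  have h1 : 0 < r - 1 := by linarith
  unfold quadArg
  field_simp
  ring

lemma cubicArg_pos {r : ℝ} (hr : 3 < r) : 0 < cubicArg r := by
  have h3 := sq_sub_three_pos hr
  have h1 : 0 < r ^ 2 - 1 := by linarith
  unfold cubicArg
  positivity

lemma quadArg_pos {r : ℝ} (hr : 3 < r) : 0 < quadArg r := by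
  have h1 : 0 < r - 1 := by linarith
  have h2 : 0 < r := by linarith
  unfold quadArg
  positivity

lemma cubicArg_lt_one {r : ℝ} (hr : 3 < r) : cubicArg r < 1 := by
  have h3 := sq_sub_three_pos hr
  have h1 : 0 < r ^ 2 - 9 := by nlinarith
  have h2 : 0 < r := by linarith
  have : 0 < 1 - cubicArg r := by
    rw [one_sub_cubicArg hr]
    positivity
  linarith

lemma quadArg_lt_one {r : ℝ} (hr : 3 < r) : quadArg r < 1 := by
  have h1 : 0 < r - 1 := by linarith
  have h3 : 0 < r - 3 := by linarith
  have : 0 < 1 - quadArg r := by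
    rw [one_sub_quadArg hr]
    positivity
  linarith

lemma hasDerivAt_cubicArg {r : ℝ} (hr : 3 < r) :
    HasDerivAt cubicArg (-108 * r ^ 3 / (r ^ 2 - 3) ^ 4) r := by
  have h3 := sq_sub_three_pos hr
  have hd := (((hasDerivAt_pow 2 r).sub_const 1).const_mul 27).div
    (((hasDerivAt_pow 2 r).sub_const 3).pow 3)
    (by simp only [Pi.pow_apply]; positivity)
  refine hd.congr_deriv ?_
  simp only [Pi.pow_apply]
  field_simp
  push_cast
  ring

lemma hasDerivAt_quadArg {r : ℝ} (hr : 3 < r) :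
    HasDerivAt quadArg (-48 * (r + 1) ^ 2 / ((r - 1) ^ 4 * (r + 3) ^ 2)) r := by
  have h1 : 0 < r - 1 := by linarith
  have hd := ((hasDerivAt_id' r).const_mul 16).div
    ((((hasDerivAt_id' r).sub_const 1).pow 3).mul ((hasDerivAt_id' r).add_const 3))
    (by simp only [Pi.mul_apply, Pi.pow_apply]; positivity)
  refine hd.congr_deriv ?_
  simp only [Pi.mul_apply, Pi.pow_apply]
  field_simp
  push_cast
  ring

lemma hasDerivAt_algFactor {r : ℝ} (hr : 3 < r) :
    HasDerivAt algFactor (algFactor r * (2 * r + 4) / ((r - 1) * (r + 3))) r := by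
  have h1 : 0 < r - 1 := by linarith
  have hs := algFactor_pos hr
  have hs2 := algFactor_sq hr
  have hd := ((((hasDerivAt_id' r).sub_const 1).pow 3).mul
    ((hasDerivAt_id' r).add_const 3)).sqrt
    (by simp only [Pi.mul_apply, Pi.pow_apply]; positivity)
  refine hd.congr_deriv ?_
  simp only [Pi.mul_apply, Pi.pow_apply]
  change _ / (2 * algFactor r) = _
  rw [div_eq_div_iff (by positivity) (by positivity)]
  push_cast
  linear_combination (-2 * (2 * r + 4)) * hs2

lemma hasDerivAt_hyp2F1_cubicArg {r : ℝ} (hr : 3 < r) :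
    HasDerivAt (fun r ↦ hyp2F1 (1 / 3) (2 / 3) 1 (cubicArg r))
      (-4 * (r ^ 2 - 3) ^ 2 / (r * (r ^ 2 - 1) * (r ^ 2 - 9)) *
        hypFlux (1 / 3) (2 / 3) (cubicArg r)) r := by
  have h0 := cubicArg_pos hr
  have h1 := cubicArg_lt_one hr
  have h := (hasDerivAt_hyp2F1 (a := 1 / 3) (b := 2 / 3) (by norm_num) (by norm_num) (by norm_num)
    h0.ne' (by rwa [abs_of_pos h0])).comp r (hasDerivAt_cubicArg hr)
  refine h.congr_deriv ?_
  rw [one_sub_cubicArg hr, cubicArg]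
  generalize hypFlux _ _ _ = V
  have h3 := sq_sub_three_pos hr
  have h9 : 0 < r ^ 2 - 9 := by nlinarith
  have h11 : 0 < r ^ 2 - 1 := by linarith
  have hr0 : 0 < r := by linarith
  field_simp
  ring

lemma hasDerivAt_hyp2F1_quadArg {r : ℝ} (hr : 3 < r) :
    HasDerivAt (fun r ↦ hyp2F1 (1 / 2) (1 / 2) 1 (quadArg r))
      (-3 * (r - 1) ^ 2 / (r * (r - 3) * (r + 1)) *
        hypFlux (1 / 2) (1 / 2) (quadArg r)) r := by
  have h0 := quadArg_pos hr
  have h1 := quadArg_lt_one hr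
  have h := (hasDerivAt_hyp2F1 (a := 1 / 2) (b := 1 / 2) (by norm_num) (by norm_num) (by norm_num)
    h0.ne' (by rwa [abs_of_pos h0])).comp r (hasDerivAt_quadArg hr)
  refine h.congr_deriv ?_
  rw [one_sub_quadArg hr, quadArg]
  generalize hypFlux _ _ _ = V
  have h3 : 0 < r - 3 := by linarith
  have h11 : 0 < r - 1 := by linarith
  have hr0 : 0 < r := by linarith
  field_simp
  ring

lemma hasDerivAt_hypFlux_cubicArg {r : ℝ} (hr : 3 < r) :
    HasDerivAt (fun r ↦ hypFlux (1 / 3) (2 / 3) (cubicArg r))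
      (-24 * r ^ 3 / (r ^ 2 - 3) ^ 4 * hyp2F1 (1 / 3) (2 / 3) 1 (cubicArg r)) r := by
  have h0 := cubicArg_pos hr
  have h1 := cubicArg_lt_one hr
  have h := (hasDerivAt_hypFlux (a := 1 / 3) (b := 2 / 3) (by norm_num) (by norm_num) (by norm_num)
    (by rwa [abs_of_pos h0])).comp r (hasDerivAt_cubicArg hr)
  exact h.congr_deriv (by ring)

lemma hasDerivAt_hypFlux_quadArg {r : ℝ} (hr : 3 < r) :
    HasDerivAt (fun r ↦ hypFlux (1 / 2) (1 / 2) (quadArg r))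
      (-12 * (r + 1) ^ 2 / ((r - 1) ^ 4 * (r + 3) ^ 2) *
        hyp2F1 (1 / 2) (1 / 2) 1 (quadArg r)) r := by
  have h0 := quadArg_pos hr
  have h1 := quadArg_lt_one hr
  have h := (hasDerivAt_hypFlux (a := 1 / 2) (b := 1 / 2) (by norm_num) (by norm_num) (by norm_num)
    (by rwa [abs_of_pos h0])).comp r (hasDerivAt_quadArg hr)
  exact h.congr_deriv (by ring)

/-- The suitably normalised Wronskian of the two sides of the cubic transformation. -/
noncomputable def cubicWronskian (r : ℝ) : ℝ :=
  3 * r * (r + 1) * (r - 3) / ((r ^ 2 - 3) ^ 2 * algFactor r) *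
      (hyp2F1 (1 / 3) (2 / 3) 1 (cubicArg r) * hyp2F1 (1 / 2) (1 / 2) 1 (quadArg r)) +
    (r ^ 2 - 3) / algFactor r *
      (hypFlux (1 / 3) (2 / 3) (cubicArg r) * hyp2F1 (1 / 2) (1 / 2) 1 (quadArg r)) -
    3 / 4 * (algFactor r / (r ^ 2 - 3)) *
      (hyp2F1 (1 / 3) (2 / 3) 1 (cubicArg r) * hypFlux (1 / 2) (1 / 2) (quadArg r))

lemma hasDerivAt_cubicWronskian {r : ℝ} (hr : 3 < r) : HasDerivAt cubicWronskian 0 r := by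
  have hs := algFactor_pos hr
  have hs2 := algFactor_sq hr
  have hD := sq_sub_three_pos hr
  have hu := hasDerivAt_hyp2F1_cubicArg hr
  have hx := hasDerivAt_hyp2F1_quadArg hr
  have hv := hasDerivAt_hypFlux_cubicArg hr
  have hy := hasDerivAt_hypFlux_quadArg hr
  have hds := hasDerivAt_algFactor hr
  have hdD := (hasDerivAt_pow 2 r).sub_const 3
  have hα := ((((hasDerivAt_id' r).const_mul 3).mul ((hasDerivAt_id' r).add_const 1)).mul
    ((hasDerivAt_id' r).sub_const 3)).div ((hdD.pow 2).mul hds)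
    (by simp only [Pi.mul_apply, Pi.pow_apply]; positivity)
  have hd := ((hα.mul (hu.mul hx)).add ((hdD.div hds hs.ne').mul (hv.mul hx))).sub
    (((hds.div hdD hD.ne').const_mul (3 / 4)).mul (hu.mul hy))
  refine hd.congr_deriv ?_
  simp only [Pi.mul_apply, Pi.pow_apply, Pi.div_apply]
  generalize hyp2F1 _ _ _ (cubicArg r) = u
  generalize hyp2F1 _ _ _ (quadArg r) = x
  generalize hypFlux _ _ (cubicArg r) = v
  generalize hypFlux _ _ (quadArg r) = y
  generalize algFactor r = s at hs hs2 ⊢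
  have h3 : 0 < r - 3 := by linarith
  have h1 : 0 < r - 1 := by linarith
  have hr0 : 0 < r := by linarith
  rw [show r ^ 2 - 9 = (r - 3) * (r + 3) by ring, show r ^ 2 - 1 = (r - 1) * (r + 1) by ring]
  field_simp
  push_cast
  rw [hs2]
  ring

/-- The ratio of the two sides of the cubic transformation. -/
noncomputable def cubicRatio (r : ℝ) : ℝ :=
  algFactor r / (r ^ 2 - 3) *
    (hyp2F1 (1 / 3) (2 / 3) 1 (cubicArg r) / hyp2F1 (1 / 2) (1 / 2) 1 (quadArg r))

lemma hyp2F1_quadArg_pos {r : ℝ} (hr : 3 < r) : 0 < hyp2F1 (1 / 2) (1 / 2) 1 (quadArg r) :=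
  hyp2F1_pos (by norm_num) (by norm_num) (by norm_num) (quadArg_pos hr).le (quadArg_lt_one hr)

lemma hasDerivAt_cubicRatio {r : ℝ} (hr : 3 < r) (hW : cubicWronskian r = 0) :
    HasDerivAt cubicRatio 0 r := by
  have hs := algFactor_pos hr
  have hs2 := algFactor_sq hr
  have hD := sq_sub_three_pos hr
  have hx0 := hyp2F1_quadArg_pos hr
  have hd := ((hasDerivAt_algFactor hr).div ((hasDerivAt_pow 2 r).sub_const 3) hD.ne').mul
    ((hasDerivAt_hyp2F1_cubicArg hr).div (hasDerivAt_hyp2F1_quadArg hr) hx0.ne')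
  refine hd.congr_deriv ?_
  simp only [Pi.div_apply]
  rw [cubicWronskian] at hW
  generalize hyp2F1 _ _ _ (cubicArg r) = u at *
  generalize hyp2F1 _ _ _ (quadArg r) = x at *
  generalize hypFlux _ _ (cubicArg r) = v at *
  generalize hypFlux _ _ (quadArg r) = y at *
  generalize algFactor r = s at *
  have h3 : 0 < r - 3 := by linarith
  have h1 : 0 < r - 1 := by linarith
  have hr0 : 0 < r := by linarith
  rw [show r ^ 2 - 9 = (r - 3) * (r + 3) by ring, show r ^ 2 - 1 = (r - 1) * (r + 1) by ring]
  trans -4 * (r - 1) ^ 2 / (r * (r + 1) * (r - 3) * x ^ 2) *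
    (3 * r * (r + 1) * (r - 3) / ((r ^ 2 - 3) ^ 2 * s) * (u * x) +
      (r ^ 2 - 3) / s * (v * x) - 3 / 4 * (s / (r ^ 2 - 3)) * (u * y))
  · field_simp
    push_cast
    rw [hs2]
    ring
  · rw [hW, mul_zero]

lemma tendsto_atTop_of_eq_comp_inv {f g : ℝ → ℝ} (hg : ContinuousAt g 0)
    (h : ∀ r, 3 < r → f r = g r⁻¹) : Tendsto f atTop (𝓝 (g 0)) := by
  refine (hg.tendsto.comp tendsto_inv_atTop_zero).congr' ?_
  filter_upwards [eventually_gt_atTop 3] with r hr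
  exact (h r hr).symm

lemma tendsto_cubicArg : Tendsto cubicArg atTop (𝓝 0) := by
  have h := tendsto_atTop_of_eq_comp_inv (f := cubicArg)
    (g := fun x ↦ 27 * x ^ 4 * (1 - x ^ 2) / (1 - 3 * x ^ 2) ^ 3)
    (ContinuousAt.div (by fun_prop) (by fun_prop) (by norm_num)) fun r hr ↦ by
      have h3 := sq_sub_three_pos hr
      have hr0 : 0 < r := by linarith
      have : 1 - 3 * r⁻¹ ^ 2 = (r ^ 2 - 3) / r ^ 2 := by field_simp
      simp only [this, cubicArg]
      field_simp
  simpa using h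

lemma tendsto_quadArg : Tendsto quadArg atTop (𝓝 0) := by
  have h := tendsto_atTop_of_eq_comp_inv (f := quadArg)
    (g := fun x ↦ 16 * x ^ 3 / ((1 - x) ^ 3 * (1 + 3 * x)))
    (ContinuousAt.div (by fun_prop) (by fun_prop) (by norm_num)) fun r hr ↦ by
      have h3 : 0 < r - 1 := by linarith
      have hr0 : 0 < r := by linarith
      have : 1 - r⁻¹ = (r - 1) / r := by field_simp
      simp only [this, quadArg]
      field_simp
  simpa using h

lemma tendsto_algFactor_div : Tendsto (fun r ↦ algFactor r / (r ^ 2 - 3)) atTop (𝓝 1) := by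
  have h := tendsto_atTop_of_eq_comp_inv (f := fun r ↦ algFactor r / (r ^ 2 - 3))
    (g := fun x ↦ √((1 - x) ^ 3 * (1 + 3 * x)) / (1 - 3 * x ^ 2))
    (ContinuousAt.div (by fun_prop) (by fun_prop) (by norm_num)) fun r hr ↦ by
      have h3 := sq_sub_three_pos hr
      have hr0 : 0 < r := by linarith
      have h1 : algFactor r = r ^ 2 * √((1 - r⁻¹) ^ 3 * (1 + 3 * r⁻¹)) := by
        rw [algFactor, show (r - 1) ^ 3 * (r + 3) =
          (r ^ 2) ^ 2 * ((1 - r⁻¹) ^ 3 * (1 + 3 * r⁻¹)) by field_simp,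
          Real.sqrt_mul (by positivity), Real.sqrt_sq (by positivity)]
      have h2 : 1 - 3 * r⁻¹ ^ 2 = (r ^ 2 - 3) / r ^ 2 := by field_simp
      simp only [h1, h2]
      field_simp
  simpa using h

lemma tendsto_cubicWronskian_coeff :
    Tendsto (fun r : ℝ ↦ 3 * r * (r + 1) * (r - 3) / (r ^ 2 - 3) ^ 3) atTop (𝓝 0) := by
  have h := tendsto_atTop_of_eq_comp_inv
    (f := fun r : ℝ ↦ 3 * r * (r + 1) * (r - 3) / (r ^ 2 - 3) ^ 3)
    (g := fun x ↦ 3 * x ^ 3 * (1 + x) * (1 - 3 * x) / (1 - 3 * x ^ 2) ^ 3)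
    (ContinuousAt.div (by fun_prop) (by fun_prop) (by norm_num)) fun r hr ↦ by
      have h3 := sq_sub_three_pos hr
      have hr0 : 0 < r := by linarith
      have : 1 - 3 * r⁻¹ ^ 2 = (r ^ 2 - 3) / r ^ 2 := by field_simp
      simp only [this]
      field_simp
  simpa using h

lemma tendsto_hyp2F1_comp {a b : ℝ} (ha : 0 < a) (hb : 0 < b) (hab : a + b = 1) {f : ℝ → ℝ}
    (hf : Tendsto f atTop (𝓝 0)) : Tendsto (fun r ↦ hyp2F1 a b 1 (f r)) atTop (𝓝 1) := by
  have h := (continuousAt_hyp2F1_zero ha hb hab).tendsto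
  rw [hyp2F1_zero] at h
  exact h.comp hf

lemma tendsto_hypFlux_comp {a b : ℝ} (ha : 0 < a) (hb : 0 < b) (hab : a + b = 1) {f : ℝ → ℝ}
    (hf : Tendsto f atTop (𝓝 0)) : Tendsto (fun r ↦ hypFlux a b (f r)) atTop (𝓝 0) := by
  have h := (continuousAt_hypFlux_zero ha hb hab).tendsto
  rw [hypFlux_zero] at h
  exact h.comp hf

lemma tendsto_cubicRatio : Tendsto cubicRatio atTop (𝓝 1) := by
  have hu := tendsto_hyp2F1_comp (a := 1 / 3) (b := 2 / 3) (by norm_num) (by norm_num)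
    (by norm_num) tendsto_cubicArg
  have hx := tendsto_hyp2F1_comp (a := 1 / 2) (b := 1 / 2) (by norm_num) (by norm_num)
    (by norm_num) tendsto_quadArg
  have h := tendsto_algFactor_div.mul (hu.div hx one_ne_zero)
  rw [div_one, mul_one] at h
  exact h

lemma tendsto_cubicWronskian : Tendsto cubicWronskian atTop (𝓝 0) := by
  have hu := tendsto_hyp2F1_comp (a := 1 / 3) (b := 2 / 3) (by norm_num) (by norm_num)
    (by norm_num) tendsto_cubicArg
  have hx := tendsto_hyp2F1_comp (a := 1 / 2) (b := 1 / 2) (by norm_num) (by norm_num)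
    (by norm_num) tendsto_quadArg
  have hv := tendsto_hypFlux_comp (a := 1 / 3) (b := 2 / 3) (by norm_num) (by norm_num)
    (by norm_num) tendsto_cubicArg
  have hy := tendsto_hypFlux_comp (a := 1 / 2) (b := 1 / 2) (by norm_num) (by norm_num)
    (by norm_num) tendsto_quadArg
  have hc := tendsto_algFactor_div
  have hc' := hc.inv₀ one_ne_zero
  have h := (((tendsto_cubicWronskian_coeff.mul hc').mul (hu.mul hx)).add
    (hc'.mul (hv.mul hx))).sub ((hc.const_mul (3 / 4)).mul (hu.mul hy))
  norm_num only at h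
  refine h.congr' ?_
  filter_upwards [eventually_gt_atTop 3] with r hr
  have hs := algFactor_pos hr
  have hD := sq_sub_three_pos hr
  simp only [cubicWronskian, inv_div]
  congr 3
  field_simp

lemma eq_of_hasDerivAt_zero_of_tendsto {f : ℝ → ℝ} {l a : ℝ} (hf : ∀ r, a < r → HasDerivAt f 0 r)
    (hl : Tendsto f atTop (𝓝 l)) {r : ℝ} (hr : a < r) : f r = l := by
  refine tendsto_nhds_unique (tendsto_const_nhds.congr' ?_) hl
  filter_upwards [eventually_gt_atTop a] with x hx
  exact isOpen_Ioi.is_const_of_deriv_eq_zero isPreconnected_Ioi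
    (fun y hy ↦ (hf y hy).differentiableAt.differentiableWithinAt)
    (fun y hy ↦ (hf y hy).deriv) (mem_Ioi.mpr hr) (mem_Ioi.mpr hx)

/-- for every real `r > 3`,
`(1/(r²−3)) ₂F₁(1/3,2/3;1;27(r²−1)/(r²−3)³)
  = (1/((r−1)^{3/2}(r+3)^{1/2})) ₂F₁(1/2,1/2;1;16r/((r−1)³(r+3)))`. -/
theorem stmt_16 (r : ℝ) (hr : 3 < r) :
    (1 / (r ^ 2 - 3)) * hyp2F1 (1 / 3) (2 / 3) 1 (27 * (r ^ 2 - 1) / (r ^ 2 - 3) ^ 3) =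
      (1 / ((r - 1) ^ ((3 : ℝ) / 2) * (r + 3) ^ ((1 : ℝ) / 2))) *
        hyp2F1 (1 / 2) (1 / 2) 1 (16 * r / ((r - 1) ^ 3 * (r + 3))) := by
  have hW : ∀ x, 3 < x → cubicWronskian x = 0 := fun x hx ↦
    eq_of_hasDerivAt_zero_of_tendsto (fun _ ↦ hasDerivAt_cubicWronskian) tendsto_cubicWronskian hx
  have h : cubicRatio r = 1 := eq_of_hasDerivAt_zero_of_tendsto
    (fun x hx ↦ hasDerivAt_cubicRatio hx (hW x hx)) tendsto_cubicRatio hr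
  have hs := algFactor_pos hr
  have hD := sq_sub_three_pos hr
  have hx := hyp2F1_quadArg_pos hr
  rw [← algFactor_eq_rpow hr]
  change 1 / (r ^ 2 - 3) * hyp2F1 (1 / 3) (2 / 3) 1 (cubicArg r) =
    1 / algFactor r * hyp2F1 (1 / 2) (1 / 2) 1 (quadArg r)
  rw [cubicRatio] at h
  field_simp at h ⊢
  linarith
end

section
/- Let g_n = ∑_{n₁+n₂+n₃=n, n_j ≥ 0} (n!/(n₁!n₂!n₃!))² and g(x) = ∑_{n=0}^∞ g_n xⁿ. Then this power series converges for all real x with |x| < 1/9, g(0) = 1, g'(0) = 3, and for all x ∈ (−1/9, 1/9): x(1−x)(1−9x)·g''(x) + (1 − 20x + 27x²)·g'(x) + (9x − 3)·g(x) = 0. -/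
/-- `gₙ = ∑_{n₁+n₂+n₃=n} (n!/(n₁!n₂!n₃!))²`, the sum of squared trinomial coefficients. -/
noncomputable def gCoeff (n : ℕ) : ℕ :=
  ∑ f ∈ Finset.Nat.antidiagonalTuple 3 n, (Nat.multinomial Finset.univ f) ^ 2

/-- `g(x) = ∑ₙ gₙ xⁿ`. -/
noncomputable def gFun (x : ℝ) : ℝ := ∑' n : ℕ, (gCoeff n : ℝ) * x ^ n

open Finset in
theorem gCoeff_eq_sum_range (n : ℕ) :
    gCoeff n = ∑ k ∈ range (n + 1), n.choose k ^ 2 * k.centralBinom := by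
  have key : gCoeff n = ∑ p ∈ antidiagonal n, ∑ q ∈ antidiagonal p.1,
      (n.choose p.1 * p.1.choose q.1) ^ 2 := by
    rw [sum_sigma', gCoeff]
    refine sum_nbij' (fun f => ⟨(f 0 + f 1, f 2), (f 0, f 1)⟩)
      (fun s => ![s.2.1, s.2.2, s.1.2]) ?_ ?_ ?_ ?_ ?_
    · intro f hf
      simpa [Nat.mem_antidiagonalTuple, Fin.sum_univ_three] using hf
    · rintro ⟨⟨a, b⟩, c, d⟩ h
      simp only [mem_sigma, HasAntidiagonal.mem_antidiagonal] at h
      simp [Nat.mem_antidiagonalTuple, Fin.sum_univ_three]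
      omega
    · intro f _
      ext i
      fin_cases i <;> rfl
    · rintro ⟨⟨a, b⟩, c, d⟩ h
      simp only [mem_sigma, HasAntidiagonal.mem_antidiagonal] at h
      obtain ⟨-, rfl⟩ := h
      rfl
    · intro f hf
      rw [Nat.mem_antidiagonalTuple, Fin.sum_univ_three] at hf
      subst hf
      have h1 := Nat.add_choose_mul_factorial_mul_factorial (f 0 + f 1) (f 2)
      have h2 := Nat.add_choose_mul_factorial_mul_factorial (f 0) (f 1)
      rw [Nat.multinomial, Fin.sum_univ_three, Fin.prod_univ_three]
      congr 1
      refine Nat.div_eq_of_eq_mul_left (by positivity) ?_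
      rw [← h1, ← h2, ← Nat.choose_symm_add, ← Nat.choose_symm_add]
      ring
  rw [key, Nat.sum_antidiagonal_eq_sum_range_succ_mk]
  refine sum_congr rfl fun k _ => ?_
  simp only [mul_pow]
  rw [← mul_sum, Nat.sum_antidiagonal_eq_sum_range_succ_mk, Nat.sum_range_choose_sq]
  rfl

theorem gCoeff_le (n : ℕ) : gCoeff n ≤ 9 ^ n := by
  have h : (∑ k ∈ Finset.range (n + 1), n.choose k * 2 ^ k) = 3 ^ n := by
    have := add_pow 2 1 n
    norm_num at this
    rw [this]
    exact Finset.sum_congr rfl fun k _ => mul_comm _ _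
  calc gCoeff n ≤ ∑ k ∈ Finset.range (n + 1), (n.choose k * 2 ^ k) ^ 2 := by
        rw [gCoeff_eq_sum_range]
        gcongr with k
        rw [mul_pow, ← pow_mul, mul_comm k 2, pow_mul]
        gcongr
        exact k.centralBinom_le_four_pow
    _ ≤ (∑ k ∈ Finset.range (n + 1), n.choose k * 2 ^ k) ^ 2 :=
        Finset.sum_sq_le_sq_sum_of_nonneg fun _ _ => Nat.zero_le _
    _ = 9 ^ n := by rw [h, ← pow_mul, mul_comm, pow_mul]; norm_num

theorem gCoeff_eq_sum_range_of_lt {n N : ℕ} (h : n < N) :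
    (gCoeff n : ℝ) = ∑ k ∈ Finset.range N, (n.choose k : ℝ) ^ 2 * k.centralBinom := by
  rw [gCoeff_eq_sum_range]
  push_cast
  refine Finset.sum_subset (Finset.range_subset_range.2 h) fun k _ hk => ?_
  rw [Nat.choose_eq_zero_of_lt (by simpa using hk)]
  simp

/-- The telescoping identity (creative telescoping) for the summand of `gCoeff_eq_sum_range`. -/
theorem sum_range_choose_sq_mul_centralBinom_telescope (n N : ℕ) :
    ∑ k ∈ Finset.range (N + 1),
      (((n : ℝ) + 2) ^ 2 * ((n + 2).choose k : ℝ) ^ 2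
        - (10 * n ^ 2 + 30 * n + 23) * ((n + 1).choose k : ℝ) ^ 2
        + 9 * (n + 1) ^ 2 * (n.choose k : ℝ) ^ 2) * k.centralBinom
      = 2 * (2 * N + 1) * (3 * N - 4 * n - 5) * ((n + 1).choose N : ℝ) ^ 2 * N.centralBinom := by
  induction N with
  | zero => simp; ring
  | succ k ih =>
    rw [Finset.sum_range_succ, ih]
    have hc : ((k : ℝ) + 1) * (k + 1).centralBinom = 2 * (2 * k + 1) * k.centralBinom := by
      exact_mod_cast k.succ_mul_centralBinom_succ
    have hP : ((n + 2).choose (k + 1) : ℝ) = (n + 1).choose k + (n + 1).choose (k + 1) := by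
      exact_mod_cast Nat.choose_succ_succ (n + 1) k
    have hB : ((n + 1).choose (k + 1) : ℝ) * (k + 1) = (n + 1 - k) * (n + 1).choose k := by
      have := Nat.choose_succ_right_eq (n + 1) k
      rcases le_or_gt k (n + 1) with h | h
      · have h' : ((n + 1 - k : ℕ) : ℝ) = n + 1 - k := by push_cast [Nat.cast_sub h]; ring
        rw [← h', mul_comm ((n + 1 - k : ℕ) : ℝ)]
        exact_mod_cast this
      · simp [Nat.choose_eq_zero_of_lt h, Nat.choose_eq_zero_of_lt (h.trans (Nat.lt_succ_self k))]
    have hC : ((n : ℝ) + 1) * n.choose (k + 1) = (n - k) * (n + 1).choose (k + 1) := by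
      have := Nat.choose_mul_succ_eq n (k + 1)
      rcases le_or_gt k n with h | h
      · have h' : ((n + 1 - (k + 1) : ℕ) : ℝ) = n - k := by
          rw [Nat.add_sub_add_right, Nat.cast_sub h]
        rw [← h', mul_comm, mul_comm ((n + 1 - (k + 1) : ℕ) : ℝ)]
        exact_mod_cast this
      · simp [Nat.choose_eq_zero_of_lt (show n + 1 < k + 1 by omega),
          Nat.choose_eq_zero_of_lt (show n < k + 1 by omega)]
    have hB' : ((n + 1).choose (k + 1) : ℝ) = (n + 1 - k) * (n + 1).choose k / (k + 1) := by
      rw [← hB]; field_simp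
    have e1 : 9 * ((n : ℝ) + 1) ^ 2 * (n.choose (k + 1) : ℝ) ^ 2
        = 9 * ((n - k) * (n + 1).choose (k + 1)) ^ 2 := by rw [← hC]; ring
    have e2 : 2 * (2 * k + 1) * (3 * k - 4 * n - 5) * ((n + 1).choose k : ℝ) ^ 2 * k.centralBinom
        = (3 * k - 4 * n - 5) * ((n + 1).choose k : ℝ) ^ 2
          * (((k : ℝ) + 1) * (k + 1).centralBinom) := by rw [hc]; ring
    rw [e1, e2, hP, hB']
    push_cast
    field_simp
    ring

theorem gCoeff_recurrence (n : ℕ) :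
    ((n : ℝ) + 2) ^ 2 * gCoeff (n + 2) - (10 * n ^ 2 + 30 * n + 23) * gCoeff (n + 1)
      + 9 * (n + 1) ^ 2 * gCoeff n = 0 := by
  have h := sum_range_choose_sq_mul_centralBinom_telescope n (n + 2)
  rw [Nat.choose_eq_zero_of_lt (show n + 1 < n + 2 by omega)] at h
  rw [gCoeff_eq_sum_range_of_lt (show n + 2 < n + 2 + 1 by omega),
    gCoeff_eq_sum_range_of_lt (show n + 1 < n + 2 + 1 by omega),
    gCoeff_eq_sum_range_of_lt (show n < n + 2 + 1 by omega), Finset.mul_sum, Finset.mul_sum,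
    Finset.mul_sum, ← Finset.sum_sub_distrib, ← Finset.sum_add_distrib]
  refine (Finset.sum_congr rfl fun k _ => by ring).trans (h.trans (by simp))

theorem gCoeff_zero : gCoeff 0 = 1 := by
  simp [gCoeff_eq_sum_range]

theorem gCoeff_one : gCoeff 1 = 3 := by
  simp [gCoeff_eq_sum_range, Finset.sum_range_succ, Nat.centralBinom, Nat.choose]

/-- A power series convergent on `(-r, r)` stays absolutely convergent there after multiplying the
coefficients by their index. -/
theorem summable_natCast_mul_norm_mul_pow {a : ℕ → ℝ} {r : ℝ}
    (ha : ∀ x : ℝ, |x| < r → Summable fun n => a n * x ^ n) {x : ℝ} (hx : |x| < r) :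
    Summable fun n : ℕ => (n : ℝ) * ‖a n * x ^ n‖ := by
  obtain ⟨s, hs, hsr⟩ := exists_between hx
  have hs0 : 0 < s := (abs_nonneg x).trans_lt hs
  obtain ⟨C, hC⟩ := (ha s (by rwa [abs_of_pos hs0])).tendsto_atTop_zero.norm.bddAbove_range
  have hq : ‖|x| / s‖ < 1 := by
    rw [Real.norm_of_nonneg (by positivity)]
    exact (div_lt_one hs0).2 hs
  have hgeom := (summable_pow_mul_geometric_of_norm_lt_one 1 hq).mul_left C
  refine hgeom.of_nonneg_of_le (fun n => by positivity) fun n => ?_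
  have hn : ‖a n * s ^ n‖ ≤ C := hC ⟨n, rfl⟩
  have e : ‖a n * x ^ n‖ = ‖a n * s ^ n‖ * (|x| / s) ^ n := by
    rw [norm_mul, norm_mul, norm_pow, norm_pow, Real.norm_of_nonneg hs0.le, Real.norm_eq_abs x,
      div_pow]
    field_simp
  rw [e]
  calc (n : ℝ) * (‖a n * s ^ n‖ * (|x| / s) ^ n) ≤ n * (C * (|x| / s) ^ n) := by gcongr
    _ = C * ((n : ℝ) ^ 1 * (|x| / s) ^ n) := by ring

theorem summable_succ_mul_pow {a : ℕ → ℝ} {r : ℝ}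
    (ha : ∀ x : ℝ, |x| < r → Summable fun n => a n * x ^ n) {x : ℝ} (hx : |x| < r) :
    Summable fun n : ℕ => ((n : ℝ) + 1) * a (n + 1) * x ^ n := by
  rcases eq_or_ne x 0 with rfl | h0
  · refine summable_of_ne_finset_zero (s := {0}) fun n hn => ?_
    rw [zero_pow (by simpa using hn), mul_zero]
  · have h := summable_natCast_mul_norm_mul_pow ha hx
    have h' : Summable fun n : ℕ => (n : ℝ) * (a n * x ^ n) :=
      Summable.of_norm (by simpa using h)
    refine (((summable_nat_add_iff 1).2 h').mul_left x⁻¹).congr fun n => ?_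
    push_cast
    field_simp
    ring

theorem hasDerivAt_tsum_mul_pow {a : ℕ → ℝ} {r : ℝ}
    (ha : ∀ x : ℝ, |x| < r → Summable fun n => a n * x ^ n) {x : ℝ} (hx : |x| < r) :
    HasDerivAt (fun y => ∑' n, a n * y ^ n) (∑' n : ℕ, ((n : ℝ) + 1) * a (n + 1) * x ^ n) x := by
  obtain ⟨s, hs, hsr⟩ := exists_between hx
  have hs0 : 0 < s := (abs_nonneg x).trans_lt hs
  have hsum := summable_natCast_mul_norm_mul_pow ha (by rwa [abs_of_pos hs0] : |s| < r)
  have hmem {y : ℝ} : y ∈ Metric.ball (0 : ℝ) s ↔ |y| < s := by simp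
  have bound (n : ℕ) (y : ℝ) (hy : y ∈ Metric.ball (0 : ℝ) s) :
      ‖a n * (n * y ^ (n - 1))‖ ≤ s⁻¹ * (n * ‖a n * s ^ n‖) := by
    rw [hmem] at hy
    rcases n with _ | n
    · simp
    · have : ‖y‖ ^ n ≤ s ^ n := by
        rw [Real.norm_eq_abs]
        gcongr
      rw [norm_mul, norm_mul, norm_mul, norm_pow, norm_pow, Real.norm_of_nonneg hs0.le,
        Real.norm_of_nonneg (Nat.cast_nonneg _), Nat.add_sub_cancel]
      calc ‖a (n + 1)‖ * ((n + 1 : ℕ) * ‖y‖ ^ n) ≤ ‖a (n + 1)‖ * ((n + 1 : ℕ) * s ^ n) := by gcongr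
        _ = s⁻¹ * ((n + 1 : ℕ) * (‖a (n + 1)‖ * s ^ (n + 1))) := by field_simp; ring
  have hball : x ∈ Metric.ball (0 : ℝ) s := hmem.2 hs
  have h := hasDerivAt_tsum_of_isPreconnected (g := fun n y => a n * y ^ n)
    (hsum.mul_left s⁻¹) Metric.isOpen_ball
    (convex_ball (0 : ℝ) s).isPreconnected
    (fun n y _ => (hasDerivAt_pow n y).const_mul (a n)) bound hball (ha x hx) hball
  convert! h using 1
  rw [(Summable.of_norm_bounded (hsum.mul_left s⁻¹) fun n => bound n x hball).tsum_eq_zero_add]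
  simp only [Nat.cast_zero, zero_mul, mul_zero, zero_add, Nat.add_sub_cancel]
  refine tsum_congr fun n => ?_
  push_cast
  ring

theorem summable_gCoeff_mul_pow {x : ℝ} (hx : |x| < 1 / 9) :
    Summable fun n : ℕ => (gCoeff n : ℝ) * x ^ n := by
  have h9 : 9 * |x| < 1 := by linarith
  refine Summable.of_norm_bounded (summable_geometric_of_lt_one (by positivity) h9) fun n => ?_
  rw [norm_mul, norm_pow, Real.norm_eq_abs x, mul_pow, Real.norm_of_nonneg (Nat.cast_nonneg _)]
  gcongr
  exact_mod_cast gCoeff_le n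

/-- the series `g(x) = ∑ gₙ xⁿ` converges for `|x| < 1/9`, satisfies
`g(0) = 1`, `g'(0) = 3`, and the Heun equation
`x(1−x)(1−9x) g'' + (1−20x+27x²) g' + (9x−3) g = 0` on `(−1/9, 1/9)`. -/
theorem stmt_17 :
    (∀ x : ℝ, |x| < 1 / 9 → Summable fun n : ℕ => (gCoeff n : ℝ) * x ^ n) ∧
      gFun 0 = 1 ∧ deriv gFun 0 = 3 ∧
      ∀ x ∈ Set.Ioo (-(1 / 9) : ℝ) (1 / 9),
        x * (1 - x) * (1 - 9 * x) * deriv (deriv gFun) x +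
          (1 - 20 * x + 27 * x ^ 2) * deriv gFun x + (9 * x - 3) * gFun x = 0 := by
  have hg : ∀ x : ℝ, |x| < 1 / 9 → Summable fun n : ℕ => (gCoeff n : ℝ) * x ^ n :=
    fun x hx => summable_gCoeff_mul_pow hx
  have hg1 := fun (x : ℝ) (hx : |x| < 1 / 9) => summable_succ_mul_pow hg hx
  have hg2 := fun (x : ℝ) (hx : |x| < 1 / 9) => summable_succ_mul_pow hg1 hx
  have d1 : ∀ x : ℝ, |x| < 1 / 9 →
      deriv gFun x = ∑' n : ℕ, ((n : ℝ) + 1) * gCoeff (n + 1) * x ^ n :=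
    fun x hx => (hasDerivAt_tsum_mul_pow hg hx).deriv
  have g0 : gFun 0 = 1 := by
    rw [gFun, tsum_eq_single 0 fun n hn => by simp [hn]]
    simp [gCoeff_zero]
  have g1 : deriv gFun 0 = 3 := by
    rw [d1 0 (by norm_num), tsum_eq_single 0 fun n hn => by simp [hn]]
    simp [gCoeff_one]
  refine ⟨hg, g0, g1, fun x hx => ?_⟩
  have hx' : |x| < 1 / 9 := abs_lt.2 hx
  have d2 : deriv (deriv gFun) x = ∑' n : ℕ,
      ((n : ℝ) + 1) * (((n + 1 : ℕ) + 1 : ℝ) * gCoeff (n + 1 + 1)) * x ^ n := by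
    have hev : deriv gFun =ᶠ[nhds x]
        fun y => ∑' n : ℕ, ((n : ℝ) + 1) * gCoeff (n + 1) * y ^ n := by
      filter_upwards [isOpen_Ioo.mem_nhds hx] with y hy
      exact d1 y (abs_lt.2 hy)
    rw [hev.deriv_eq]
    exact (hasDerivAt_tsum_mul_pow hg1 hx').deriv
  rcases eq_or_ne x 0 with rfl | h0
  · simp [g0, g1]
  rw [d1 x hx', d2]
  have u0 : HasSum (fun n => (gCoeff n : ℝ) * x ^ n) (gFun x) := (hg x hx').hasSum
  have v1 := (hg1 x hx').hasSum
  have v2 := (hg2 x hx').hasSum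
  set B := ∑' n : ℕ, ((n : ℝ) + 1) * gCoeff (n + 1) * x ^ n
  set C := ∑' n : ℕ, ((n : ℝ) + 1) * (((n + 1 : ℕ) + 1 : ℝ) * gCoeff (n + 1 + 1)) * x ^ n
  have u1 : HasSum (fun n : ℕ => (n : ℝ) * (gCoeff n * x ^ n)) (x * B) := by
    rw [← hasSum_nat_add_iff' 1]
    convert! v1.mul_left x using 1
    · ext n
      push_cast
      ring
    · simp
  have u2 : HasSum (fun n : ℕ => (n : ℝ) * (n - 1) * (gCoeff n * x ^ n)) (x ^ 2 * C) := by
    rw [← hasSum_nat_add_iff' 2]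
    convert! v2.mul_left (x ^ 2) using 1
    · ext n
      push_cast
      ring
    · simp [Finset.sum_range_succ]
  have w0 := (hasSum_nat_add_iff' 2).2 (u2.add u1)
  have w1 := (hasSum_nat_add_iff' 1).2
    (((u2.mul_left 10).add (u1.mul_left 20)).add (u0.mul_left 3))
  have w2 := (u2.add (u1.mul_left 3)).add u0
  have w := (w0.sub (w1.mul_left x)).add (w2.mul_left (9 * x ^ 2))
  rw [show (fun n : ℕ => _) = fun _ => (0 : ℝ) from funext fun n => by
    have := gCoeff_recurrence n
    push_cast
    linear_combination x ^ (n + 2) * this] at w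
  have key := w.unique hasSum_zero
  simp only [Finset.sum_range_succ, Finset.sum_range_zero, gCoeff_zero, gCoeff_one] at key
  refine mul_left_cancel₀ h0 ?_
  push_cast at key
  linear_combination key
end
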